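/- arXiv:2004.00692 — 5 statements merged into one kernel-verified Lean document; each statement's English description precedes it below -/
import Mathlib

section
/- Generalized Hardy inequality with spherical weight: There exists a constant C > 0 such that for every continuously differentiable function v : (0, π) → ℝ, ∫₀^π ( v'(θ) + (cos θ / sin θ) v(θ) )² sin θ dθ + ∫₀^π v(θ)² sin θ dθ ≥ C ∫₀^π v(θ)² (sin θ)⁻¹ dθ, where all three integrals are taken in [0, ∞] (Lebesgue integrals of nonnegative functions, possibly infinite). -/
open MeasureTheory

open Set

/-- The modified angular derivative `d + (cos / sin) v`, where `d` is the derivative of `v`. -/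
noncomputable def angularDeriv (v d : ℝ → ℝ) (x : ℝ) : ℝ :=
  d x + (Real.cos x / Real.sin x) * v x

lemma continuousOn_angularDeriv {v d : ℝ → ℝ} (hv : ContinuousOn v (Ioo 0 Real.pi))
    (hd : ContinuousOn d (Ioo 0 Real.pi)) : ContinuousOn (angularDeriv v d) (Ioo 0 Real.pi) :=
  hd.add ((Real.continuous_cos.continuousOn.div Real.continuous_sin.continuousOn
    fun _ hx => (Real.sin_pos_of_mem_Ioo hx).ne').mul hv)

lemma uIcc_subset_Ioo_zero_pi {a b : ℝ} (ha : 0 < a) (hab : a ≤ b) (hb : b < Real.pi) :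
    uIcc a b ⊆ Ioo 0 Real.pi := by
  rw [uIcc_of_le hab]
  exact fun x hx => ⟨ha.trans_le hx.1, hx.2.trans_lt hb⟩

/-- Cauchy-Schwarz for the increment of `sin * v`. -/
lemma sq_sin_mul_sub_le {v d : ℝ → ℝ} (hv : ∀ x ∈ Ioo 0 Real.pi, HasDerivAt v (d x) x)
    (hd : ContinuousOn d (Ioo 0 Real.pi)) {a b : ℝ} (ha : 0 < a) (hab : a < b)
    (hb : b < Real.pi) :
    (Real.sin b * v b - Real.sin a * v a) ^ 2 ≤
      (Real.cos a - Real.cos b) * ∫ x in a..b, angularDeriv v d x ^ 2 * Real.sin x := by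
  have hsub := uIcc_subset_Ioo_zero_pi ha hab.le hb
  have hvc : ContinuousOn v (Ioo 0 Real.pi) := fun x hx => (hv x hx).continuousAt.continuousWithinAt
  have hDc := (continuousOn_angularDeriv hvc hd).mono hsub
  have hs : ContinuousOn Real.sin (uIcc a b) := Real.continuous_sin.continuousOn
  have hint1 : IntervalIntegrable (fun x => angularDeriv v d x * Real.sin x) volume a b :=
    (hDc.mul hs).intervalIntegrable
  have hint2 : IntervalIntegrable (fun x => angularDeriv v d x ^ 2 * Real.sin x) volume a b :=
    ((hDc.pow 2).mul hs).intervalIntegrable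
  have hint3 : IntervalIntegrable Real.sin volume a b := hs.intervalIntegrable
  have hFTC : ∫ x in a..b, angularDeriv v d x * Real.sin x =
      Real.sin b * v b - Real.sin a * v a := by
    refine intervalIntegral.integral_eq_sub_of_hasDerivAt
      (f := fun x => Real.sin x * v x) (fun x hx => ?_) hint1
    refine ((Real.hasDerivAt_sin x).mul (hv x (hsub hx))).congr_deriv ?_
    have := (Real.sin_pos_of_mem_Ioo (hsub hx)).ne'
    simp only [angularDeriv]
    field_simp
    ring
  have hm : 0 < Real.cos a - Real.cos b :=
    sub_pos.2 (Real.cos_lt_cos_of_nonneg_of_le_pi ha.le hb.le hab)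
  set m := Real.cos a - Real.cos b
  set δ := Real.sin b * v b - Real.sin a * v a
  have hnn : 0 ≤ ∫ x in a..b, (m ^ 2 * (angularDeriv v d x ^ 2 * Real.sin x) -
      2 * m * δ * (angularDeriv v d x * Real.sin x) + δ ^ 2 * Real.sin x) := by
    refine intervalIntegral.integral_nonneg hab.le fun x hx => ?_
    have hsx := Real.sin_pos_of_mem_Ioo (hsub (by rwa [uIcc_of_le hab.le]))
    have : 0 ≤ (m * angularDeriv v d x - δ) ^ 2 * Real.sin x := by positivity
    linarith
  rw [intervalIntegral.integral_add ((hint2.const_mul _).sub (hint1.const_mul _))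
      (hint3.const_mul _),
    intervalIntegral.integral_sub (hint2.const_mul _) (hint1.const_mul _),
    intervalIntegral.integral_const_mul, intervalIntegral.integral_const_mul,
    intervalIntegral.integral_const_mul, hFTC, integral_sin] at hnn
  change 0 ≤ _ - _ + δ ^ 2 * m at hnn
  refine le_of_mul_le_mul_left ?_ hm
  linarith

lemma exists_abs_sin_mul_lt {v : ℝ → ℝ}
    (hI : IntervalIntegrable (fun x => v x ^ 2 * Real.sin x) volume 0 Real.pi)
    {δ η : ℝ} (hδ : 0 < δ) (hδ' : δ < Real.pi) (hη : 0 < η) :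
    ∃ x ∈ Ioo 0 δ, |Real.sin x * v x| < η := by
  by_contra! h
  have hsub : Ioo 0 δ ⊆ Ioo 0 Real.pi := Ioo_subset_Ioo_right hδ'.le
  have h1 : IntegrableOn (fun x => (η ^ 2)⁻¹ * (v x ^ 2 * Real.sin x)) (Ioo 0 δ) :=
    (((intervalIntegrable_iff_integrableOn_Ioo_of_le Real.pi_pos.le).1 hI).mono_set hsub).const_mul _
  have h2 : IntegrableOn (fun x : ℝ => x⁻¹) (Ioo 0 δ) := by
    refine h1.mono' measurable_inv.aestronglyMeasurable ?_
    refine (ae_restrict_iff' measurableSet_Ioo).2 (.of_forall fun x hx => ?_)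
    have hs := Real.sin_pos_of_mem_Ioo (hsub hx)
    have hx0 : 0 < x := hx.1
    have hsx := Real.sin_lt hx0
    have hw : η ^ 2 ≤ (Real.sin x * v x) ^ 2 := by
      rw [← sq_abs (Real.sin x * v x)]
      exact pow_le_pow_left₀ hη.le (h x hx) 2
    rw [Real.norm_of_nonneg (inv_nonneg.2 hx0.le), inv_mul_eq_div, le_div_iff₀ (by positivity),
      inv_mul_le_iff₀ hx0]
    calc η ^ 2 ≤ Real.sin x * (v x ^ 2 * Real.sin x) := by linarith
      _ ≤ x * (v x ^ 2 * Real.sin x) := by gcongr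
  rw [← intervalIntegrable_iff_integrableOn_Ioo_of_le hδ.le] at h2
  have := intervalIntegrable_inv_iff.1 h2
  simp [hδ.ne, hδ.le] at this

/-- Finite energy functions are bounded near the pole `0`. -/
lemma sq_le_integral_angularDeriv {v d : ℝ → ℝ}
    (hv : ∀ x ∈ Ioo 0 Real.pi, HasDerivAt v (d x) x) (hd : ContinuousOn d (Ioo 0 Real.pi))
    (hD : IntervalIntegrable (fun x => angularDeriv v d x ^ 2 * Real.sin x) volume 0 Real.pi)
    (hI : IntervalIntegrable (fun x => v x ^ 2 * Real.sin x) volume 0 Real.pi)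
    {a : ℝ} (ha : 0 < a) (ha' : a ≤ Real.pi / 2) :
    v a ^ 2 ≤ ∫ x in 0..Real.pi, angularDeriv v d x ^ 2 * Real.sin x := by
  set R := ∫ x in 0..Real.pi, angularDeriv v d x ^ 2 * Real.sin x with hR
  have hpi := Real.pi_pos
  have haπ : a < Real.pi := by linarith
  have hs : 0 < Real.sin a := Real.sin_pos_of_pos_of_lt_pi ha haπ
  have hc : 0 ≤ Real.cos a := Real.cos_nonneg_of_neg_pi_div_two_le_of_le (by linarith) ha'
  have hc1 := Real.cos_le_one a
  have hnn : ∀ x ∈ Ioc 0 Real.pi, 0 ≤ angularDeriv v d x ^ 2 * Real.sin x := fun x hx =>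
    mul_nonneg (sq_nonneg _) (Real.sin_nonneg_of_nonneg_of_le_pi hx.1.le hx.2)
  have hR0 : 0 ≤ R := by
    rw [hR, intervalIntegral.integral_of_le hpi.le]
    exact setIntegral_nonneg measurableSet_Ioc hnn
  have key : |Real.sin a * v a| ≤ √((1 - Real.cos a) * R) := by
    refine le_of_forall_pos_le_add fun η hη => ?_
    obtain ⟨e, he, hlt⟩ := exists_abs_sin_mul_lt hI ha haπ hη
    have h1 := sq_sin_mul_sub_le hv hd he.1 he.2 haπ
    have h2 : ∫ x in e..a, angularDeriv v d x ^ 2 * Real.sin x ≤ R := by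
      refine intervalIntegral.integral_mono_interval he.1.le he.2.le haπ.le ?_ hD
      exact (ae_restrict_iff' measurableSet_Ioc).2 (.of_forall hnn)
    have h3 : (Real.sin a * v a - Real.sin e * v e) ^ 2 ≤ (1 - Real.cos a) * R := by
      refine h1.trans ?_
      have h4 := Real.cos_le_one e
      have h5 := Real.cos_lt_cos_of_nonneg_of_le_pi he.1.le haπ.le he.2
      calc _ ≤ (Real.cos e - Real.cos a) * R := by gcongr
        _ ≤ _ := by gcongr
    have h6 := Real.abs_le_sqrt h3
    have h7 := abs_sub_abs_le_abs_sub (Real.sin a * v a) (Real.sin e * v e)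
    linarith
  have h8 : (Real.sin a * v a) ^ 2 ≤ (1 - Real.cos a) * R :=
    sq_abs (Real.sin a * v a) ▸
      (Real.le_sqrt (abs_nonneg _) (mul_nonneg (by linarith) hR0)).1 key
  have h9 : (1 - Real.cos a) * R ≤ Real.sin a ^ 2 * R := by
    gcongr
    nlinarith [Real.sin_sq_add_cos_sq a]
  refine le_of_mul_le_mul_left ?_ (pow_pos hs 2)
  linarith [mul_pow (Real.sin a) (v a) 2]

/-- Finite energy functions are bounded near the pole `π`. -/
lemma sq_le_integral_angularDeriv' {v d : ℝ → ℝ}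
    (hv : ∀ x ∈ Ioo 0 Real.pi, HasDerivAt v (d x) x) (hd : ContinuousOn d (Ioo 0 Real.pi))
    (hD : IntervalIntegrable (fun x => angularDeriv v d x ^ 2 * Real.sin x) volume 0 Real.pi)
    (hI : IntervalIntegrable (fun x => v x ^ 2 * Real.sin x) volume 0 Real.pi)
    {b : ℝ} (hb : Real.pi / 2 ≤ b) (hb' : b < Real.pi) :
    v b ^ 2 ≤ ∫ x in 0..Real.pi, angularDeriv v d x ^ 2 * Real.sin x := by
  have hmaps : MapsTo (fun x => Real.pi - x) (Ioo 0 Real.pi) (Ioo 0 Real.pi) :=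
    fun x hx => ⟨sub_pos.2 hx.2, sub_lt_self _ hx.1⟩
  have hrefl : (fun x => angularDeriv (fun y => v (Real.pi - y)) (fun y => -d (Real.pi - y)) x ^ 2 *
      Real.sin x) = fun x => angularDeriv v d (Real.pi - x) ^ 2 * Real.sin (Real.pi - x) := by
    funext x
    simp only [angularDeriv, Real.sin_pi_sub, Real.cos_pi_sub]
    ring
  have hD' := (hD.comp_sub_left Real.pi).symm
  have hI' := (hI.comp_sub_left Real.pi).symm
  simp only [sub_zero, sub_self] at hD' hI'
  have h := sq_le_integral_angularDeriv (v := fun y => v (Real.pi - y))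
    (d := fun y => -d (Real.pi - y)) (a := Real.pi - b)
    (fun x hx => by
      have h1 := (hv _ (hmaps hx)).scomp x ((hasDerivAt_id x).const_sub Real.pi)
      simpa [Function.comp_def] using h1)
    ((hd.comp (by fun_prop) hmaps).neg) (by rw [hrefl]; exact hD')
    (by simpa only [Real.sin_pi_sub] using hI') (by linarith) (by linarith)
  rw [hrefl, intervalIntegral.integral_comp_sub_left
    (fun x => angularDeriv v d x ^ 2 * Real.sin x)] at h
  simpa using h

/-- The Hardy inequality on a compact subinterval, with boundary terms. -/
lemma integral_sq_div_sin_le {v d : ℝ → ℝ}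
    (hv : ∀ x ∈ Ioo 0 Real.pi, HasDerivAt v (d x) x) (hd : ContinuousOn d (Ioo 0 Real.pi))
    {a b : ℝ} (ha : 0 < a) (hab : a ≤ b) (hb : b < Real.pi) :
    ∫ x in a..b, v x ^ 2 * (Real.sin x)⁻¹ ≤
      (∫ x in a..b, angularDeriv v d x ^ 2 * Real.sin x) + (∫ x in a..b, v x ^ 2 * Real.sin x) +
        v a ^ 2 + v b ^ 2 := by
  have hsub := uIcc_subset_Ioo_zero_pi ha hab hb
  have hvc : ContinuousOn v (Ioo 0 Real.pi) := fun x hx => (hv x hx).continuousAt.continuousWithinAt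
  have hDc := (continuousOn_angularDeriv hvc hd).mono hsub
  have hvc' := hvc.mono hsub
  have hs : ContinuousOn Real.sin (uIcc a b) := Real.continuous_sin.continuousOn
  have hcos : ContinuousOn Real.cos (uIcc a b) := Real.continuous_cos.continuousOn
  have hi1 : IntervalIntegrable (fun x => v x ^ 2 * (Real.sin x)⁻¹) volume a b :=
    ((hvc'.pow 2).mul (hs.inv₀ fun x hx => (Real.sin_pos_of_mem_Ioo (hsub hx)).ne')).intervalIntegrable
  have hi2 : IntervalIntegrable (fun x => angularDeriv v d x ^ 2 * Real.sin x) volume a b :=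
    ((hDc.pow 2).mul hs).intervalIntegrable
  have hi3 : IntervalIntegrable (fun x => v x ^ 2 * Real.sin x) volume a b :=
    ((hvc'.pow 2).mul hs).intervalIntegrable
  have hi4 : IntervalIntegrable
      (fun x => Real.cos x * (v x * angularDeriv v d x)) volume a b :=
    (hcos.mul (hvc'.mul hDc)).intervalIntegrable
  have hi5 : IntervalIntegrable (fun x => 2 * (v x ^ 2 * (Real.sin x)⁻¹) - v x ^ 2 * Real.sin x -
      2 * (Real.cos x * (v x * angularDeriv v d x))) volume a b :=
    ((hi1.const_mul _).sub hi3).sub (hi4.const_mul _)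
  have hFTC := intervalIntegral.integral_eq_sub_of_hasDerivAt
    (f := fun x => -Real.cos x * v x ^ 2) (fun x hx => by
      refine ((Real.hasDerivAt_cos x).neg.mul ((hv x (hsub hx)).pow 2)).congr_deriv ?_
      have hsx := (Real.sin_pos_of_mem_Ioo (hsub hx)).ne'
      simp only [angularDeriv, Pi.neg_apply, Pi.pow_apply]
      field_simp
      push_cast
      linear_combination (2 * v x ^ 2) * Real.cos_sq' x) hi5
  have hle : ∫ x in a..b, v x ^ 2 * (Real.sin x)⁻¹ ≤ ∫ x in a..b,
      ((2 * (v x ^ 2 * (Real.sin x)⁻¹) - v x ^ 2 * Real.sin x -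
        2 * (Real.cos x * (v x * angularDeriv v d x))) +
        angularDeriv v d x ^ 2 * Real.sin x) + v x ^ 2 * Real.sin x := by
    refine intervalIntegral.integral_mono_on hab hi1 ((hi5.add hi2).add hi3) fun x hx => ?_
    have hsx := Real.sin_pos_of_mem_Ioo (hsub (by rwa [uIcc_of_le hab]))
    set D := angularDeriv v d x
    have h1 : 0 ≤ (v x * Real.cos x - D * Real.sin x) ^ 2 * (Real.sin x)⁻¹ := by positivity
    have h2 : (v x * Real.cos x - D * Real.sin x) ^ 2 * (Real.sin x)⁻¹ =
        v x ^ 2 * (Real.sin x)⁻¹ - v x ^ 2 * Real.sin x - 2 * (Real.cos x * (v x * D)) +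
          D ^ 2 * Real.sin x := by
      field_simp
      linear_combination (v x ^ 2) * Real.cos_sq' x
    have h3 : 0 ≤ v x ^ 2 * Real.sin x := by positivity
    linarith
  rw [intervalIntegral.integral_add (hi5.add hi2) hi3, intervalIntegral.integral_add hi5 hi2,
    hFTC] at hle
  have h1 : Real.cos a * v a ^ 2 ≤ v a ^ 2 :=
    mul_le_of_le_one_left (sq_nonneg _) (Real.cos_le_one a)
  have h2 : -Real.cos b * v b ^ 2 ≤ v b ^ 2 :=
    mul_le_of_le_one_left (sq_nonneg _) (by linarith [Real.neg_one_le_cos b])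
  linarith

lemma intervalIntegrable_of_lintegral_ne_top {f : ℝ → ℝ} {a b : ℝ} (hab : a ≤ b)
    (hf : ContinuousOn f (Ioo a b)) (hnn : ∀ x ∈ Ioo a b, 0 ≤ f x)
    (hfin : ∫⁻ x in Ioo a b, ENNReal.ofReal (f x) ≠ ⊤) :
    IntervalIntegrable f volume a b := by
  rw [intervalIntegrable_iff_integrableOn_Ioo_of_le hab]
  exact (lintegral_ofReal_ne_top_iff_integrable (hf.aestronglyMeasurable measurableSet_Ioo)
    ((ae_restrict_iff' measurableSet_Ioo).2 (.of_forall hnn))).1 hfin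

lemma ofReal_intervalIntegral_eq_lintegral_Ioo {f : ℝ → ℝ} {a b : ℝ} (hab : a ≤ b)
    (hf : IntervalIntegrable f volume a b) (hnn : ∀ x ∈ Ioo a b, 0 ≤ f x) :
    ENNReal.ofReal (∫ x in a..b, f x) = ∫⁻ x in Ioo a b, ENNReal.ofReal (f x) := by
  rw [intervalIntegral.integral_of_le hab, integral_Ioc_eq_integral_Ioo]
  exact ofReal_integral_eq_lintegral_ofReal
    ((intervalIntegrable_iff_integrableOn_Ioo_of_le hab).1 hf)
    ((ae_restrict_iff' measurableSet_Ioo).2 (.of_forall hnn))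

lemma lintegral_Ioo_le_of_forall_intervalIntegral_le {f : ℝ → ℝ} {A B c M : ℝ}
    (hA : A < c) (hB : c < B) (hf : ContinuousOn f (Ioo A B)) (hnn : ∀ x ∈ Ioo A B, 0 ≤ f x)
    (h : ∀ a b, A < a → a ≤ c → c ≤ b → b < B → ∫ x in a..b, f x ≤ M) :
    ∫⁻ x in Ioo A B, ENNReal.ofReal (f x) ≤ ENNReal.ofReal M := by
  obtain ⟨a, -, ha, ha'⟩ := exists_seq_strictAnti_tendsto' hA
  obtain ⟨b, -, hb, hb'⟩ := exists_seq_strictMono_tendsto' hB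
  have hmeas : AEMeasurable (fun x => ENNReal.ofReal (f x)) (volume.restrict (Ioo A B)) :=
    (hf.aemeasurable measurableSet_Ioo).ennreal_ofReal
  refine le_of_tendsto ((aecover_Ioo_of_Ioo ha' hb').lintegral_tendsto_of_countably_generated
    hmeas) (.of_forall fun n => ?_)
  have hab : a n ≤ b n := (ha n).2.le.trans (hb n).1.le
  have hsub : Icc (a n) (b n) ⊆ Ioo A B := fun x hx =>
    ⟨(ha n).1.trans_le hx.1, hx.2.trans_lt (hb n).2⟩
  rw [Measure.restrict_restrict measurableSet_Ioo,
    inter_eq_self_of_subset_left (Ioo_subset_Icc_self.trans hsub),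
    ← ofReal_intervalIntegral_eq_lintegral_Ioo hab
      (hf.mono (by rwa [uIcc_of_le hab])).intervalIntegrable
      fun x hx => hnn x (hsub (Ioo_subset_Icc_self hx))]
  exact ENNReal.ofReal_le_ofReal (h _ _ (ha n).1 (ha n).2.le (hb n).1.le (hb n).2)

/-- Generalized Hardy inequality with spherical weight (Lemma 4.1 of the paper). -/
theorem generalized_hardy_inequality :
    ∃ C : ℝ, 0 < C ∧
      ∀ v : ℝ → ℝ, ContDiffOn ℝ 1 v (Set.Ioo 0 Real.pi) →
        ENNReal.ofReal C *
            ∫⁻ θ in Set.Ioo 0 Real.pi, ENNReal.ofReal (v θ ^ 2 * (Real.sin θ)⁻¹) ≤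
          (∫⁻ θ in Set.Ioo 0 Real.pi,
              ENNReal.ofReal
                ((deriv v θ + (Real.cos θ / Real.sin θ) * v θ) ^ 2 * Real.sin θ))
            + ∫⁻ θ in Set.Ioo 0 Real.pi, ENNReal.ofReal (v θ ^ 2 * Real.sin θ) := by
  refine ⟨1 / 3, by norm_num, fun v hv => ?_⟩
  have hpi := Real.pi_pos
  change _ ≤ (∫⁻ θ in Ioo 0 Real.pi,
    ENNReal.ofReal (angularDeriv v (deriv v) θ ^ 2 * Real.sin θ)) + _
  by_cases hD : ∫⁻ θ in Ioo 0 Real.pi,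
    ENNReal.ofReal (angularDeriv v (deriv v) θ ^ 2 * Real.sin θ) = ⊤
  · simp [hD]
  by_cases hI : ∫⁻ θ in Ioo 0 Real.pi, ENNReal.ofReal (v θ ^ 2 * Real.sin θ) = ⊤
  · simp [hI]
  have hd : ContinuousOn (deriv v) (Ioo 0 Real.pi) :=
    hv.continuousOn_deriv_of_isOpen isOpen_Ioo le_rfl
  have hvd : ∀ x ∈ Ioo 0 Real.pi, HasDerivAt v (deriv v x) x := fun x hx =>
    ((hv.differentiableOn one_ne_zero).differentiableAt (isOpen_Ioo.mem_nhds hx)).hasDerivAt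
  have hs : ContinuousOn Real.sin (Ioo 0 Real.pi) := Real.continuous_sin.continuousOn
  have hspos : ∀ x ∈ Ioo 0 Real.pi, 0 < Real.sin x := fun x hx => Real.sin_pos_of_mem_Ioo hx
  have hDnn : ∀ x ∈ Ioo 0 Real.pi, 0 ≤ angularDeriv v (deriv v) x ^ 2 * Real.sin x :=
    fun x hx => mul_nonneg (sq_nonneg _) (hspos x hx).le
  have hInn : ∀ x ∈ Ioo 0 Real.pi, 0 ≤ v x ^ 2 * Real.sin x :=
    fun x hx => mul_nonneg (sq_nonneg _) (hspos x hx).le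
  have hD' := intervalIntegrable_of_lintegral_ne_top
    (f := fun x => angularDeriv v (deriv v) x ^ 2 * Real.sin x) hpi.le
    (((continuousOn_angularDeriv hv.continuousOn hd).pow 2).mul hs) hDnn hD
  have hI' := intervalIntegrable_of_lintegral_ne_top (f := fun x => v x ^ 2 * Real.sin x) hpi.le
    ((hv.continuousOn.pow 2).mul hs) hInn hI
  have hDae : 0 ≤ᵐ[volume.restrict (Ioc 0 Real.pi)]
      fun x => angularDeriv v (deriv v) x ^ 2 * Real.sin x :=
    (ae_restrict_iff' measurableSet_Ioc).2 (.of_forall fun x hx =>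
      mul_nonneg (sq_nonneg _) (Real.sin_nonneg_of_nonneg_of_le_pi hx.1.le hx.2))
  have hIae : 0 ≤ᵐ[volume.restrict (Ioc 0 Real.pi)] fun x => v x ^ 2 * Real.sin x :=
    (ae_restrict_iff' measurableSet_Ioc).2 (.of_forall fun x hx =>
      mul_nonneg (sq_nonneg _) (Real.sin_nonneg_of_nonneg_of_le_pi hx.1.le hx.2))
  have hD0 : 0 ≤ ∫ x in 0..Real.pi, angularDeriv v (deriv v) x ^ 2 * Real.sin x :=
    intervalIntegral.integral_nonneg_of_ae_restrict hpi.le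
      (by rwa [Measure.restrict_congr_set Ioc_ae_eq_Icc] at hDae)
  have hI0 : 0 ≤ ∫ x in 0..Real.pi, v x ^ 2 * Real.sin x :=
    intervalIntegral.integral_nonneg_of_ae_restrict hpi.le
      (by rwa [Measure.restrict_congr_set Ioc_ae_eq_Icc] at hIae)
  have hmain := lintegral_Ioo_le_of_forall_intervalIntegral_le
    (f := fun x => v x ^ 2 * (Real.sin x)⁻¹) (c := Real.pi / 2)
    (M := 3 * ((∫ x in 0..Real.pi, angularDeriv v (deriv v) x ^ 2 * Real.sin x) +
      ∫ x in 0..Real.pi, v x ^ 2 * Real.sin x)) (by linarith) (by linarith)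
    ((hv.continuousOn.pow 2).mul (hs.inv₀ fun x hx => (hspos x hx).ne'))
    (fun x hx => mul_nonneg (sq_nonneg _) (inv_nonneg.2 (hspos x hx).le))
    (fun a b ha hac hcb hb => by
      have hab := hac.trans hcb
      have h1 := integral_sq_div_sin_le hvd hd ha hab hb
      have h2 := sq_le_integral_angularDeriv hvd hd hD' hI' ha hac
      have h3 := sq_le_integral_angularDeriv' hvd hd hD' hI' hcb hb
      have h4 := intervalIntegral.integral_mono_interval ha.le hab hb.le hDae hD'
      have h5 := intervalIntegral.integral_mono_interval ha.le hab hb.le hIae hI'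
      linarith)
  rw [← ofReal_intervalIntegral_eq_lintegral_Ioo hpi.le hD' hDnn,
    ← ofReal_intervalIntegral_eq_lintegral_Ioo hpi.le hI' hInn, ← ENNReal.ofReal_add hD0 hI0]
  refine (mul_le_mul_right hmain _).trans_eq ?_
  rw [← ENNReal.ofReal_mul (by norm_num)]
  congr 1
  ring
end

section
/- Consequence of the generalized Hardy inequality: There exists a constant C′ > 0 such that for every continuously differentiable function v : (0, π) → ℝ, ∫₀^π ( v'(θ) + (cos θ / sin θ) v(θ) )² sin θ dθ + ∫₀^π v(θ)² sin θ dθ ≥ C′ ∫₀^π v'(θ)² sin θ dθ, where all integrals are taken in [0, ∞] (Lebesgue integrals of nonnegative functions, possibly infinite). -/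
open MeasureTheory

open Set Real Filter Topology

/-- A function whose square is integrable against `sin` cannot stay away from zero, after
multiplication by `sin`, near a zero `c` of the sine. -/
lemma exists_abs_sin_mul_le_of_integrableOn {v : ℝ → ℝ} {p q c ε : ℝ} (hp : 0 ≤ p) (hq : q ≤ π)
    (hpq : p < q) (hc : c ∈ uIcc p q) (hsin : ∀ θ ∈ Ioo p q, sin θ ≤ |θ - c|) (hε : 0 < ε)
    (hF : IntegrableOn (fun θ ↦ v θ ^ 2 * sin θ) (Ioo 0 π)) :
    ∃ s ∈ Ioo p q, |sin s * v s| ≤ ε := by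
  by_contra! h
  have hint : IntegrableOn (fun θ ↦ (θ - c)⁻¹) (Ioo p q) := by
    have hF' : IntegrableOn (fun θ ↦ (ε ^ 2)⁻¹ * (v θ ^ 2 * sin θ)) (Ioo p q) :=
      (hF.mono_set (Ioo_subset_Ioo hp hq)).const_mul _
    refine Integrable.mono' hF' (by fun_prop) ?_
    filter_upwards [self_mem_ae_restrict measurableSet_Ioo] with θ hθ
    have hs : 0 < sin θ := sin_pos_of_pos_of_lt_pi (hp.trans_lt hθ.1) (hθ.2.trans_le hq)
    have hsq : ε ^ 2 ≤ (sin θ * v θ) ^ 2 := by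
      rw [← sq_abs (sin θ * v θ)]
      exact pow_le_pow_left₀ hε.le (h θ hθ).le 2
    rw [norm_inv, norm_eq_abs]
    calc |θ - c|⁻¹ ≤ (sin θ)⁻¹ := inv_anti₀ hs (hsin θ hθ)
      _ = (ε ^ 2)⁻¹ * (ε ^ 2 * (sin θ)⁻¹) := by field_simp
      _ ≤ (ε ^ 2)⁻¹ * ((sin θ * v θ) ^ 2 * (sin θ)⁻¹) := by gcongr
      _ = (ε ^ 2)⁻¹ * (v θ ^ 2 * sin θ) := by field_simp
  have := (intervalIntegrable_iff_integrableOn_Ioo_of_le hpq.le).2 hint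
  rw [intervalIntegrable_sub_inv_iff] at this
  exact this.elim hpq.ne fun h ↦ h hc

lemma sq_mul_sin_nonneg_ae (u : ℝ → ℝ) :
    0 ≤ᵐ[volume.restrict (Ioo 0 π)] fun θ ↦ u θ ^ 2 * sin θ := by
  filter_upwards [self_mem_ae_restrict measurableSet_Ioo] with θ hθ
  have := sin_pos_of_pos_of_lt_pi hθ.1 hθ.2
  simp only [Pi.zero_apply]
  positivity

lemma intervalIntegral_sq_mul_sin_le_setIntegral {u : ℝ → ℝ} {a b : ℝ} (ha : 0 < a) (hb : b < π)
    (hab : a ≤ b) (hu : IntegrableOn (fun θ ↦ u θ ^ 2 * sin θ) (Ioo 0 π)) :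
    ∫ θ in a..b, u θ ^ 2 * sin θ ≤ ∫ θ in Ioo 0 π, u θ ^ 2 * sin θ := by
  rw [intervalIntegral.integral_of_le hab]
  exact setIntegral_mono_set hu (sq_mul_sin_nonneg_ae u)
    (Ioc_subset_Icc_self.trans (Icc_subset_Ioo ha hb)).eventuallyLE

/-- The duality form of the Cauchy-Schwarz bound for increments of `sin · v`, whose derivative is
`sin` times the modified angular derivative of `v`. -/
lemma two_mul_sin_mul_sub_le {v g : ℝ → ℝ} {a b : ℝ} (ha : 0 < a) (hb : b < π) (hab : a ≤ b)
    (hv : ∀ θ ∈ Ioo 0 π, HasDerivAt v (g θ) θ)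
    (hE : IntegrableOn (fun θ ↦ (g θ + cos θ / sin θ * v θ) ^ 2 * sin θ) (Ioo 0 π)) (l : ℝ) :
    2 * l * (sin b * v b - sin a * v a) ≤
      (∫ θ in Ioo 0 π, (g θ + cos θ / sin θ * v θ) ^ 2 * sin θ) + l ^ 2 * (cos a - cos b) := by
  have hsub : Icc a b ⊆ Ioo 0 π := Icc_subset_Ioo ha hb
  have hder : ∀ θ ∈ Ioo 0 π, HasDerivAt (fun θ ↦ 2 * l * (sin θ * v θ) + l ^ 2 * cos θ)
      (2 * l * (cos θ * v θ + sin θ * g θ) + l ^ 2 * -sin θ) θ := fun θ hθ ↦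
    (((hasDerivAt_sin θ).mul (hv θ hθ)).const_mul _).add ((hasDerivAt_cos θ).const_mul _)
  have key := intervalIntegral.sub_le_integral_of_hasDeriv_right_of_le hab
    (fun θ hθ ↦ (hder θ (hsub hθ)).continuousAt.continuousWithinAt)
    (fun θ hθ ↦ (hder θ (hsub (Ioo_subset_Icc_self hθ))).hasDerivWithinAt)
    (hE.mono_set hsub) (fun θ hθ ↦ by
      have hθ' := hsub (Ioo_subset_Icc_self hθ)
      have hs : 0 < sin θ := sin_pos_of_pos_of_lt_pi hθ'.1 hθ'.2
      have : (g θ + cos θ / sin θ * v θ) ^ 2 * sin θ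
          - (2 * l * (cos θ * v θ + sin θ * g θ) + l ^ 2 * -sin θ)
          = (g θ + cos θ / sin θ * v θ - l) ^ 2 * sin θ := by
        field_simp
        ring
      have : 0 ≤ (g θ + cos θ / sin θ * v θ - l) ^ 2 * sin θ := by positivity
      linarith)
  have hmono := intervalIntegral_sq_mul_sin_le_setIntegral ha hb hab hE
  linarith

lemma sq_le_of_forall_two_mul_le {x s k E : ℝ} (hs : 0 < s) (hk : k ≤ s ^ 2)
    (h : ∀ l : ℝ, ∀ ε > 0, 2 * l * (s * x) ≤ E + l ^ 2 * k + 2 * |l| * ε) : x ^ 2 ≤ E := by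
  have h' : 2 * (x / s) * (s * x) ≤ E + (x / s) ^ 2 * k := by
    refine le_of_forall_pos_le_add fun δ hδ ↦ ?_
    have hpos : 0 < 2 * |x / s| + 1 := by positivity
    refine (h (x / s) (δ / (2 * |x / s| + 1)) (by positivity)).trans ?_
    gcongr
    rw [mul_div_assoc', div_le_iff₀ hpos]
    nlinarith
  have h1 : 2 * (x / s) * (s * x) = 2 * x ^ 2 := by field_simp
  have h2 : (x / s) ^ 2 * k ≤ x ^ 2 := by
    calc (x / s) ^ 2 * k ≤ (x / s) ^ 2 * s ^ 2 := by gcongr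
      _ = x ^ 2 := by field_simp
  linarith

lemma sq_le_setIntegral_of_le_pi_div_two {v g : ℝ → ℝ}
    (hv : ∀ θ ∈ Ioo 0 π, HasDerivAt v (g θ) θ)
    (hE : IntegrableOn (fun θ ↦ (g θ + cos θ / sin θ * v θ) ^ 2 * sin θ) (Ioo 0 π))
    (hF : IntegrableOn (fun θ ↦ v θ ^ 2 * sin θ) (Ioo 0 π))
    {a : ℝ} (ha : 0 < a) (ha' : a ≤ π / 2) :
    v a ^ 2 ≤ ∫ θ in Ioo 0 π, (g θ + cos θ / sin θ * v θ) ^ 2 * sin θ := by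
  have haπ : a < π := by linarith [pi_pos]
  have hcos : 0 ≤ cos a := cos_nonneg_of_mem_Icc ⟨by linarith [pi_pos], ha'⟩
  refine sq_le_of_forall_two_mul_le (k := 1 - cos a) (sin_pos_of_pos_of_lt_pi ha haπ) ?_ ?_
  · nlinarith [sin_sq_add_cos_sq a, cos_le_one a]
  intro l ε hε
  obtain ⟨s, hs, hsε⟩ := exists_abs_sin_mul_le_of_integrableOn (c := 0) le_rfl haπ.le ha
    left_mem_uIcc (fun θ hθ ↦ by
      rw [sub_zero, abs_of_pos hθ.1]
      exact sin_le hθ.1.le) hε hF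
  have h1 := two_mul_sin_mul_sub_le hs.1 haπ hs.2.le hv hE l
  have h2 : l * (sin s * v s) ≤ |l| * ε :=
    (le_abs_self _).trans (by rw [abs_mul]; gcongr)
  have h3 : l ^ 2 * (cos s - cos a) ≤ l ^ 2 * (1 - cos a) := by
    gcongr
    exact cos_le_one s
  linarith

lemma sq_le_setIntegral_of_pi_div_two_le {v g : ℝ → ℝ}
    (hv : ∀ θ ∈ Ioo 0 π, HasDerivAt v (g θ) θ)
    (hE : IntegrableOn (fun θ ↦ (g θ + cos θ / sin θ * v θ) ^ 2 * sin θ) (Ioo 0 π))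
    (hF : IntegrableOn (fun θ ↦ v θ ^ 2 * sin θ) (Ioo 0 π))
    {b : ℝ} (hb : b < π) (hb' : π / 2 ≤ b) :
    v b ^ 2 ≤ ∫ θ in Ioo 0 π, (g θ + cos θ / sin θ * v θ) ^ 2 * sin θ := by
  have hb0 : 0 < b := by linarith [pi_pos]
  have hcos : cos b ≤ 0 := cos_nonpos_of_pi_div_two_le_of_le hb' (by linarith)
  refine sq_le_of_forall_two_mul_le (k := 1 + cos b) (sin_pos_of_pos_of_lt_pi hb0 hb) ?_ ?_
  · nlinarith [sin_sq_add_cos_sq b, neg_one_le_cos b]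
  intro l ε hε
  obtain ⟨s, hs, hsε⟩ := exists_abs_sin_mul_le_of_integrableOn (c := π) hb0.le le_rfl hb
    right_mem_uIcc (fun θ hθ ↦ by
      rw [abs_sub_comm, abs_of_pos (sub_pos.2 hθ.2), ← sin_pi_sub]
      exact sin_le (sub_pos.2 hθ.2).le) hε hF
  have h1 := two_mul_sin_mul_sub_le hb0 hs.2 hs.1.le hv hE (-l)
  have h2 : l * (sin s * v s) ≤ |l| * ε :=
    (le_abs_self _).trans (by rw [abs_mul]; gcongr)
  have h3 : l ^ 2 * (cos b - cos s) ≤ l ^ 2 * (1 + cos b) := by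
    gcongr
    linarith [neg_one_le_cos s]
  rw [neg_sq] at h1
  linarith

lemma intervalIntegral_deriv_sq_mul_sin_le {v g : ℝ → ℝ}
    (hv : ∀ θ ∈ Ioo 0 π, HasDerivAt v (g θ) θ)
    (hE : IntegrableOn (fun θ ↦ (g θ + cos θ / sin θ * v θ) ^ 2 * sin θ) (Ioo 0 π))
    (hF : IntegrableOn (fun θ ↦ v θ ^ 2 * sin θ) (Ioo 0 π))
    (hg : ContinuousOn g (Ioo 0 π)) {a b : ℝ} (ha : 0 < a) (ha' : a ≤ π / 2) (hb : b < π)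
    (hb' : π / 2 ≤ b) :
    ∫ θ in a..b, g θ ^ 2 * sin θ ≤
      3 * ∫ θ in Ioo 0 π, (g θ + cos θ / sin θ * v θ) ^ 2 * sin θ := by
  have hab : a ≤ b := ha'.trans hb'
  have hsub : Icc a b ⊆ Ioo 0 π := Icc_subset_Ioo ha hb
  have hgi : IntegrableOn (fun θ ↦ g θ ^ 2 * sin θ) (Icc a b) :=
    (((hg.mono hsub).pow 2).mul continuousOn_sin).integrableOn_Icc
  have hei := hE.mono_set hsub
  have hder : ∀ θ ∈ Ioo 0 π, HasDerivAt (fun θ ↦ cos θ * (v θ * v θ))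
      (-sin θ * (v θ * v θ) + cos θ * (g θ * v θ + v θ * g θ)) θ := fun θ hθ ↦
    (hasDerivAt_cos θ).mul ((hv θ hθ).mul (hv θ hθ))
  have key := intervalIntegral.sub_le_integral_of_hasDeriv_right_of_le hab
    (fun θ hθ ↦ (hder θ (hsub hθ)).continuousAt.continuousWithinAt)
    (fun θ hθ ↦ (hder θ (hsub (Ioo_subset_Icc_self hθ))).hasDerivWithinAt)
    (hei.sub hgi) (fun θ hθ ↦ by
      have hθ' := hsub (Ioo_subset_Icc_self hθ)
      have hs : 0 < sin θ := sin_pos_of_pos_of_lt_pi hθ'.1 hθ'.2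
      have h1 : (g θ + cos θ / sin θ * v θ) ^ 2 * sin θ - g θ ^ 2 * sin θ
          - (-sin θ * (v θ * v θ) + cos θ * (g θ * v θ + v θ * g θ))
          = cos θ ^ 2 / sin θ * v θ ^ 2 + sin θ * v θ ^ 2 := by
        field_simp
        ring
      have h2 : 0 ≤ cos θ ^ 2 / sin θ * v θ ^ 2 + sin θ * v θ ^ 2 := by positivity
      simp only [Pi.sub_apply]
      linarith)
  simp only [Pi.sub_apply] at key
  rw [intervalIntegral.integral_sub
    ((intervalIntegrable_iff_integrableOn_Icc_of_le hab).2 hei)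
    ((intervalIntegrable_iff_integrableOn_Icc_of_le hab).2 hgi)] at key
  have hmono := intervalIntegral_sq_mul_sin_le_setIntegral ha hb hab hE
  have hva := sq_le_setIntegral_of_le_pi_div_two hv hE hF ha ha'
  have hvb := sq_le_setIntegral_of_pi_div_two_le hv hE hF hb hb'
  nlinarith [cos_le_one a, neg_one_le_cos b, sq_nonneg (v a), sq_nonneg (v b)]

/-- Consequence of the generalized Hardy inequality (estimate (4.4) of the paper). -/
theorem generalized_hardy_consequence :
    ∃ C' : ℝ, 0 < C' ∧
      ∀ v : ℝ → ℝ, ContDiffOn ℝ 1 v (Set.Ioo 0 Real.pi) →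
        ENNReal.ofReal C' *
            ∫⁻ θ in Set.Ioo 0 Real.pi, ENNReal.ofReal ((deriv v θ) ^ 2 * Real.sin θ) ≤
          (∫⁻ θ in Set.Ioo 0 Real.pi,
              ENNReal.ofReal
                ((deriv v θ + (Real.cos θ / Real.sin θ) * v θ) ^ 2 * Real.sin θ))
            + ∫⁻ θ in Set.Ioo 0 Real.pi, ENNReal.ofReal (v θ ^ 2 * Real.sin θ) := by
  refine ⟨1 / 3, by norm_num, fun v hv ↦ ?_⟩
  have hsin : ∀ θ ∈ Ioo 0 π, 0 < sin θ := fun θ hθ ↦ sin_pos_of_pos_of_lt_pi hθ.1 hθ.2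
  have hder : ∀ θ ∈ Ioo 0 π, HasDerivAt v (deriv v θ) θ := fun θ hθ ↦
    ((hv.differentiableOn one_ne_zero).differentiableAt (isOpen_Ioo.mem_nhds hθ)).hasDerivAt
  have hg : ContinuousOn (deriv v) (Ioo 0 π) :=
    hv.continuousOn_deriv_of_isOpen isOpen_Ioo le_rfl
  have hec : ContinuousOn (fun θ ↦ (deriv v θ + cos θ / sin θ * v θ) ^ 2 * sin θ) (Ioo 0 π) :=
    ((hg.add ((continuousOn_cos.div continuousOn_sin fun θ hθ ↦ (hsin θ hθ).ne').mul
      hv.continuousOn)).pow 2).mul continuousOn_sin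
  have hfc : ContinuousOn (fun θ ↦ v θ ^ 2 * sin θ) (Ioo 0 π) :=
    (hv.continuousOn.pow 2).mul continuousOn_sin
  by_cases hEtop : ∫⁻ θ in Ioo 0 π,
      ENNReal.ofReal ((deriv v θ + cos θ / sin θ * v θ) ^ 2 * sin θ) = ⊤
  · simp [hEtop]
  by_cases hFtop : ∫⁻ θ in Ioo 0 π, ENNReal.ofReal (v θ ^ 2 * sin θ) = ⊤
  · simp [hFtop]
  have hE : IntegrableOn (fun θ ↦ (deriv v θ + cos θ / sin θ * v θ) ^ 2 * sin θ) (Ioo 0 π) :=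
    (lintegral_ofReal_ne_top_iff_integrable (hec.aestronglyMeasurable measurableSet_Ioo)
      (sq_mul_sin_nonneg_ae _)).1 hEtop
  have hF : IntegrableOn (fun θ ↦ v θ ^ 2 * sin θ) (Ioo 0 π) :=
    (lintegral_ofReal_ne_top_iff_integrable (hfc.aestronglyMeasurable measurableSet_Ioo)
      (sq_mul_sin_nonneg_ae _)).1 hFtop
  refine le_add_right ?_
  rw [← ofReal_integral_eq_lintegral_ofReal hE (sq_mul_sin_nonneg_ae _)]
  set E := ∫ θ in Ioo 0 π, (deriv v θ + cos θ / sin θ * v θ) ^ 2 * sin θ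
  have ha : Tendsto (fun n : ℕ ↦ π / 2 * (1 / ((n : ℝ) + 1))) atTop (𝓝 0) := by
    simpa using tendsto_one_div_add_atTop_nhds_zero_nat.const_mul (π / 2)
  have hb : Tendsto (fun n : ℕ ↦ π - π / 2 * (1 / ((n : ℝ) + 1))) atTop (𝓝 π) := by
    simpa using ha.const_sub π
  have hlim := (aecover_Ioo_of_Icc (μ := volume) ha hb).lintegral_tendsto_of_countably_generated
    (f := fun θ ↦ ENNReal.ofReal (deriv v θ ^ 2 * sin θ))
    ((hg.pow 2).mul continuousOn_sin |>.aestronglyMeasurable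
      measurableSet_Ioo).aemeasurable.ennreal_ofReal
  have hbound : ∫⁻ θ in Ioo 0 π, ENNReal.ofReal (deriv v θ ^ 2 * sin θ) ≤
      ENNReal.ofReal (3 * E) := by
    refine le_of_tendsto hlim (Eventually.of_forall fun n ↦ ?_)
    set d : ℝ := π / 2 * (1 / ((n : ℝ) + 1)) with hd
    have hd0 : 0 < d := by positivity
    have hd1 : d ≤ π / 2 := by
      have : 1 / ((n : ℝ) + 1) ≤ 1 := by
        rw [div_le_one (by positivity)]
        linarith [n.cast_nonneg (α := ℝ)]
      rw [hd]
      nlinarith [pi_pos]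
    have hsub : Icc d (π - d) ⊆ Ioo 0 π := Icc_subset_Ioo hd0 (by linarith)
    have hgi : IntegrableOn (fun θ ↦ deriv v θ ^ 2 * sin θ) (Icc d (π - d)) :=
      (((hg.mono hsub).pow 2).mul continuousOn_sin).integrableOn_Icc
    rw [Measure.restrict_restrict_of_subset hsub,
      ← ofReal_integral_eq_lintegral_ofReal hgi (ae_restrict_of_ae_restrict_of_subset hsub
        (sq_mul_sin_nonneg_ae _)), integral_Icc_eq_integral_Ioc,
      ← intervalIntegral.integral_of_le (by linarith)]
    exact ENNReal.ofReal_le_ofReal (intervalIntegral_deriv_sq_mul_sin_le hder hE hF hg hd0 hd1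
      (by linarith) (by linarith))
  calc _ ≤ ENNReal.ofReal (1 / 3) * ENNReal.ofReal (3 * E) := by gcongr
    _ = ENNReal.ofReal E := by
      rw [← ENNReal.ofReal_mul (by norm_num)]
      congr 1
      ring
end

section
/- Fuchsian energy estimate (forward): Let E be a real normed vector space, let c₀ > 0 and r⋆ > 0, let f : (0, r⋆] → ℝ be continuous with |f(r)| ≤ c₀ / r for all r ∈ (0, r⋆], let G : (0, r⋆] → E be continuous, and let u : (0, r⋆] → E be differentiable with u'(r) + f(r) u(r) = G(r) for all r ∈ (0, r⋆]. Then for every r ∈ (0, r⋆], ‖u(r)‖ ≤ (r⋆ / r)^{c₀} ‖u(r⋆)‖ + r^{−c₀} ∫_r^{r⋆} s^{c₀} ‖G(s)‖ ds. -/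
open MeasureTheory

/-- The primitive of a function continuous on `(a, b]` is differentiable inside the interval. -/
theorem hasDerivAt_integral_of_continuousOn_Ioc {g : ℝ → ℝ} {a b r s : ℝ}
    (hg : ContinuousOn g (Set.Ioc a b)) (har : a < r) (hrs : r ≤ s) (hsb : s < b) :
    HasDerivAt (fun t => ∫ x in r..t, g x) (g s) s := by
  have hs : s ∈ Set.Ioo a b := ⟨har.trans_le hrs, hsb⟩
  have hg' : ContinuousOn g (Set.Ioo a b) := hg.mono Set.Ioo_subset_Ioc_self
  refine intervalIntegral.integral_hasDerivAt_right ?_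
    (hg'.stronglyMeasurableAtFilter isOpen_Ioo s hs) (hg'.continuousAt (isOpen_Ioo.mem_nhds hs))
  refine (hg.mono fun x hx => ?_).intervalIntegrable
  rw [Set.uIcc_of_le hrs] at hx
  exact ⟨har.trans_le hx.1, hx.2.trans hsb.le⟩

/-- The primitive of a function continuous on `[a, b]` is continuous there. -/
theorem continuousOn_integral_of_continuousOn_Icc {g : ℝ → ℝ} {a b : ℝ} (hab : a ≤ b)
    (hg : ContinuousOn g (Set.Icc a b)) :
    ContinuousOn (fun t => ∫ x in a..t, g x) (Set.Icc a b) := by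
  have h := intervalIntegral.continuousOn_primitive_interval (μ := volume) (f := g) (a := a) (b := b)
    (by rw [Set.uIcc_of_le hab]; exact hg.integrableOn_Icc)
  rwa [Set.uIcc_of_le hab] at h

/-- If `f ≤ c / x` on `[r, s]`, then the integrating factor `exp (∫ f)` is at most `(s / r) ^ c`. -/
theorem exp_integral_le_div_rpow {f : ℝ → ℝ} {c r s : ℝ} (hr : 0 < r) (hrs : r ≤ s)
    (hfc : ContinuousOn f (Set.Icc r s)) (hf : ∀ x ∈ Set.Icc r s, f x ≤ c / x) :
    Real.exp (∫ x in r..s, f x) ≤ (s / r) ^ c := by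
  have hs : 0 < s := hr.trans_le hrs
  rw [Real.rpow_def_of_pos (div_pos hs hr), Real.exp_le_exp]
  have hint : ∫ x in r..s, c / x = Real.log (s / r) * c := by
    simp only [div_eq_mul_inv c, intervalIntegral.integral_const_mul]
    rw [integral_inv_of_pos hr hs, mul_comm]
  rw [← hint]
  refine intervalIntegral.integral_mono_on hrs (hfc.intervalIntegrable_of_Icc hrs) ?_ hf
  refine ContinuousOn.intervalIntegrable_of_Icc hrs ?_
  exact continuousOn_const.div continuousOn_id fun x hx => ne_of_gt (hr.trans_le hx.1)

/-- Fuchsian energy estimate, forward version (Lemma 4.5 of the paper). -/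
theorem fuchsian_energy_estimate
    {E : Type*} [NormedAddCommGroup E] [NormedSpace ℝ E]
    (c₀ rstar : ℝ) (hc₀ : 0 < c₀) (hrstar : 0 < rstar)
    (f : ℝ → ℝ) (hf_cont : ContinuousOn f (Set.Ioc 0 rstar))
    (hf : ∀ r ∈ Set.Ioc 0 rstar, |f r| ≤ c₀ / r)
    (G : ℝ → E) (hG_cont : ContinuousOn G (Set.Ioc 0 rstar))
    (u : ℝ → E)
    (hu : ∀ r ∈ Set.Ioc 0 rstar, HasDerivAt u (G r - f r • u r) r) :
    ∀ r ∈ Set.Ioc 0 rstar,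
      ‖u r‖ ≤ (rstar / r) ^ c₀ * ‖u rstar‖
        + r ^ (-c₀) * ∫ s in r..rstar, s ^ c₀ * ‖G s‖ := by
  rintro r ⟨hr, hrR⟩
  have hsub : Set.Icc r rstar ⊆ Set.Ioc 0 rstar := fun x hx => ⟨hr.trans_le hx.1, hx.2⟩
  set φ : ℝ → ℝ := fun s => Real.exp (∫ x in r..s, f x) with hφ
  have hφ_le : ∀ s ∈ Set.Icc r rstar, φ s ≤ (s / r) ^ c₀ := fun s hs =>
    exp_integral_le_div_rpow hr hs.1
      (hf_cont.mono ((Set.Icc_subset_Icc_right hs.2).trans hsub))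
      fun x hx => (le_abs_self _).trans (hf x (hsub ⟨hx.1, hx.2.trans hs.2⟩))
  have hφ_cont : ContinuousOn φ (Set.Icc r rstar) :=
    (continuousOn_integral_of_continuousOn_Icc hrR (hf_cont.mono hsub)).rexp
  have hu_cont : ContinuousOn u (Set.Icc r rstar) := fun s hs =>
    (hu s (hsub hs)).continuousAt.continuousWithinAt
  have hg_cont : ContinuousOn (fun s => (s / r) ^ c₀ * ‖G s‖) (Set.Ioc 0 rstar) :=
    ((continuousOn_id.div_const r).rpow_const fun _ _ => Or.inr hc₀.le).mul hG_cont.norm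
  have hderiv : ∀ s ∈ Set.Ico r rstar,
      HasDerivAt (fun t => φ t • u t - u r) (φ s • G s) s := fun s hs => by
    have h := ((hasDerivAt_integral_of_continuousOn_Ioc hf_cont hr hs.1 hs.2).exp.smul
      (hu s (hsub ⟨hs.1, hs.2.le⟩))).sub_const (u r)
    refine h.congr_deriv ?_
    simp only [hφ]
    module
  have hmain : ‖φ rstar • u rstar - u r‖ ≤ ∫ s in r..rstar, (s / r) ^ c₀ * ‖G s‖ :=
    image_norm_le_of_norm_deriv_right_le_deriv_boundary'
      ((hφ_cont.smul hu_cont).sub continuousOn_const)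
      (fun s hs => (hderiv s hs).hasDerivWithinAt) (by simp [hφ])
      (continuousOn_integral_of_continuousOn_Icc hrR (hg_cont.mono hsub))
      (fun s hs =>
        (hasDerivAt_integral_of_continuousOn_Ioc hg_cont hr hs.1 hs.2).hasDerivWithinAt)
      (fun s hs => by
        rw [norm_smul, Real.norm_of_nonneg (Real.exp_pos _).le]
        gcongr
        exact hφ_le s ⟨hs.1, hs.2.le⟩)
      ⟨hrR, le_rfl⟩
  have hint : ∫ s in r..rstar, (s / r) ^ c₀ * ‖G s‖
      = r ^ (-c₀) * ∫ s in r..rstar, s ^ c₀ * ‖G s‖ := by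
    rw [← intervalIntegral.integral_const_mul]
    refine intervalIntegral.integral_congr fun s hs => ?_
    rw [Set.uIcc_of_le hrR] at hs
    simp only [Real.div_rpow (hr.le.trans hs.1) hr.le, Real.rpow_neg hr.le]
    ring
  rw [← hint]
  calc ‖u r‖ ≤ ‖φ rstar • u rstar‖ + ‖φ rstar • u rstar - u r‖ := norm_le_norm_add_norm_sub _ _
    _ ≤ (rstar / r) ^ c₀ * ‖u rstar‖ + ∫ s in r..rstar, (s / r) ^ c₀ * ‖G s‖ := by
      rw [norm_smul, Real.norm_of_nonneg (Real.exp_pos _).le]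
      gcongr
      exact hφ_le rstar ⟨hrR, le_rfl⟩
end

section
/- Backwards solvability of a forced Fuchsian ODE from the singularity, with the singular branch set to zero: Let β ∈ ℝ, r₀ > 0, B > 0, M > 0 and δ ∈ (0, 1]. Let f : (0, r₀] → ℝ be continuous with |f(r) − β/r| ≤ B r^{−3/4} for all r ∈ (0, r₀], and let G : (0, r₀] → ℝ be continuous with |G(r)| ≤ M r^{−β−1+δ} for all r ∈ (0, r₀]. Then there exists exactly one continuously differentiable function u : (0, r₀] → ℝ satisfying u'(r) + f(r) u(r) = G(r) for all r ∈ (0, r₀] together with the vanishing condition r^{β} u(r) → 0 as r → 0⁺; moreover this solution satisfies |u(r)| ≤ (M/δ) · exp(8 B r₀^{1/4}) · r^{−β+δ} for all r ∈ (0, r₀]. -/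
open Filter

/-- If `|g s| ≤ C s ^ (p - 1)` with `p > 0`, the integral of `g` over `[a, b]` is at most
`(C / p) b ^ p`, uniformly in `a ∈ [0, b]`. -/
lemma abs_intervalIntegral_le_of_le_rpow {g : ℝ → ℝ} {C p a b : ℝ} (hC : 0 ≤ C) (hp : 0 < p)
    (ha : 0 ≤ a) (hab : a ≤ b) (hg : ∀ s ∈ Set.Ioc a b, |g s| ≤ C * s ^ (p - 1)) :
    |∫ s in a..b, g s| ≤ C / p * b ^ p := by
  have hp' : -1 < p - 1 := by linarith
  have h := intervalIntegral.norm_integral_le_of_norm_le (f := g)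
    (μ := MeasureTheory.volume) hab
    (Eventually.of_forall hg)
    ((intervalIntegral.intervalIntegrable_rpow' (a := a) (b := b) hp').const_mul C)
  rw [intervalIntegral.integral_const_mul, integral_rpow (Or.inl hp'), sub_add_cancel] at h
  calc |∫ s in a..b, g s| ≤ C * ((b ^ p - a ^ p) / p) := h
    _ = C / p * b ^ p - C / p * a ^ p := by ring
    _ ≤ C / p * b ^ p := by
      have : 0 ≤ C / p * a ^ p := by positivity
      linarith

/-- A function continuous on `(0, ∞)` and bounded by an integrable power near `0` is integrable
up to `0`. -/
lemma intervalIntegrable_zero_of_le_rpow {g : ℝ → ℝ} {C p b : ℝ} (hp : 0 < p) (hb : 0 ≤ b)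
    (hg_cont : ContinuousOn g (Set.Ioi 0)) (hg : ∀ s ∈ Set.Ioc 0 b, |g s| ≤ C * s ^ (p - 1)) :
    IntervalIntegrable g MeasureTheory.volume 0 b := by
  have hp' : -1 < p - 1 := by linarith
  refine ((intervalIntegral.intervalIntegrable_rpow' (a := 0) (b := b) hp').const_mul C).mono_fun'
    ?_ ?_
  · rw [Set.uIoc_of_le hb]
    exact (hg_cont.mono fun x hx => hx.1).aestronglyMeasurable measurableSet_Ioc
  · rw [Set.uIoc_of_le hb]
    exact (MeasureTheory.ae_restrict_iff' measurableSet_Ioc).2 (Eventually.of_forall hg)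

/-- The fundamental theorem of calculus at `r > 0` for an integrand continuous on `(0, ∞)`. -/
lemma hasDerivAt_intervalIntegral_of_continuousOn_Ioi {g : ℝ → ℝ} {a r : ℝ} (hr : 0 < r)
    (hg_cont : ContinuousOn g (Set.Ioi 0)) (hg : IntervalIntegrable g MeasureTheory.volume a r) :
    HasDerivAt (fun x => ∫ s in a..x, g s) (g r) r :=
  intervalIntegral.integral_hasDerivAt_right hg
    (hg_cont.stronglyMeasurableAtFilter isOpen_Ioi r hr)
    (hg_cont.continuousAt (Ioi_mem_nhds hr))

/-- A continuous function on `(0, b]` extends continuously by a constant to `(0, ∞)`. -/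
lemma ContinuousOn.comp_min_Ioi {g : ℝ → ℝ} {b : ℝ} (hb : 0 < b)
    (hg : ContinuousOn g (Set.Ioc 0 b)) : ContinuousOn (fun x => g (min x b)) (Set.Ioi 0) :=
  hg.comp (by fun_prop) fun _ hx => ⟨lt_min hx hb, min_le_right _ _⟩

/-- A function with zero derivative on `(0, b]` that tends to `0` at `0⁺` vanishes on `(0, b]`. -/
lemma eq_zero_of_hasDerivAt_zero_of_tendsto_zero {g : ℝ → ℝ} {b : ℝ}
    (hg : ∀ r ∈ Set.Ioc 0 b, HasDerivAt g 0 r)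
    (hlim : Tendsto g (nhdsWithin 0 (Set.Ioi 0)) (nhds 0)) :
    ∀ r ∈ Set.Ioc 0 b, g r = 0 := by
  intro r hr
  refine tendsto_nhds_unique (tendsto_const_nhds.congr' ?_) hlim
  filter_upwards [Ioc_mem_nhdsGT hr.1] with s hs
  have hsub : ∀ x ∈ Set.Icc s r, x ∈ Set.Ioc 0 b := fun x hx =>
    ⟨hs.1.trans_le hx.1, hx.2.trans hr.2⟩
  exact constant_of_has_deriv_right_zero
    (fun x hx => (hg x (hsub x hx)).continuousAt.continuousWithinAt)
    (fun x hx => (hg x (hsub x ⟨hx.1, hx.2.le⟩)).hasDerivWithinAt) r ⟨hs.2, le_rfl⟩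

/-- The coefficient `f` admits an integrating factor `φ` comparable to `r ^ β`. -/
lemma exists_integratingFactor {β r₀ B : ℝ} (hr₀ : 0 < r₀) (hB : 0 < B) {f : ℝ → ℝ}
    (hf_cont : ContinuousOn f (Set.Ioc 0 r₀))
    (hf : ∀ r ∈ Set.Ioc 0 r₀, |f r - β / r| ≤ B * r ^ (-(3 : ℝ)/4)) :
    ∃ φ : ℝ → ℝ, (∀ r ∈ Set.Ioc 0 r₀, HasDerivAt φ (φ r * f r) r) ∧
      ∀ r ∈ Set.Ioc 0 r₀, Real.exp (-(4 * B * r₀ ^ ((1 : ℝ)/4))) * r ^ β ≤ φ r ∧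
        φ r ≤ Real.exp (4 * B * r₀ ^ ((1 : ℝ)/4)) * r ^ β := by
  set h : ℝ → ℝ := fun x => f (min x r₀) - β / x with h_def
  have hh_cont : ContinuousOn h (Set.Ioi 0) :=
    (hf_cont.comp_min_Ioi hr₀).sub
      (continuousOn_const.div continuousOn_id fun x hx => (Set.mem_Ioi.1 hx).ne')
  have hh : ∀ r ∈ Set.Ioc 0 r₀, h r = f r - β / r := fun r hr => by
    simp only [h_def, min_eq_left hr.2]
  have hh_le : ∀ r ∈ Set.Ioc 0 r₀, |h r| ≤ B * r ^ ((1 : ℝ)/4 - 1) := fun r hr => by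
    rw [hh r hr]
    convert hf r hr using 3
    norm_num
  have hint : ∀ r ∈ Set.Ioc 0 r₀, IntervalIntegrable h MeasureTheory.volume r₀ r := by
    intro r hr
    refine (hh_cont.mono fun x hx => ?_).intervalIntegrable
    rw [Set.uIcc_of_ge hr.2] at hx
    exact hr.1.trans_le hx.1
  have hH_le : ∀ r ∈ Set.Ioc 0 r₀, |∫ s in r₀..r, h s| ≤ 4 * B * r₀ ^ ((1 : ℝ)/4) := by
    intro r hr
    rw [intervalIntegral.integral_symm, abs_neg]
    refine (abs_intervalIntegral_le_of_le_rpow hB.le (by norm_num : (0 : ℝ) < 1 / 4) hr.1.le hr.2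
      fun s hs => hh_le s ⟨hr.1.trans hs.1, hs.2⟩).trans_eq ?_
    ring
  refine ⟨fun r => Real.exp (∫ s in r₀..r, h s) * r ^ β, fun r hr => ?_, fun r hr => ?_⟩
  · have hd := (hasDerivAt_intervalIntegral_of_continuousOn_Ioi hr.1 hh_cont (hint r hr)).exp.mul
      (Real.hasDerivAt_rpow_const (p := β) (Or.inl hr.1.ne'))
    refine hd.congr_deriv ?_
    rw [hh r hr, Real.rpow_sub_one hr.1.ne']
    ring
  · have hpos : 0 ≤ r ^ β := Real.rpow_nonneg hr.1.le β
    obtain ⟨h1, h2⟩ := abs_le.1 (hH_le r hr)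
    exact ⟨mul_le_mul_of_nonneg_right (Real.exp_le_exp.2 h1) hpos,
      mul_le_mul_of_nonneg_right (Real.exp_le_exp.2 h2) hpos⟩

/-- Backwards solvability of a forced Fuchsian ODE from the singularity, with the
singular branch set to zero. -/
theorem fuchsian_backwards_solvability
    (β r₀ B M δ : ℝ) (hr₀ : 0 < r₀) (hB : 0 < B) (hM : 0 < M)
    (hδ : δ ∈ Set.Ioc (0 : ℝ) 1)
    (f G : ℝ → ℝ)
    (hf_cont : ContinuousOn f (Set.Ioc 0 r₀))
    (hf : ∀ r ∈ Set.Ioc 0 r₀, |f r - β / r| ≤ B * r ^ (-(3 : ℝ)/4))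
    (hG_cont : ContinuousOn G (Set.Ioc 0 r₀))
    (hG : ∀ r ∈ Set.Ioc 0 r₀, |G r| ≤ M * r ^ (-β - 1 + δ)) :
    ∃ u : ℝ → ℝ,
      ((∀ r ∈ Set.Ioc 0 r₀, HasDerivAt u (G r - f r * u r) r) ∧
        Tendsto (fun r : ℝ => r ^ β * u r) (nhdsWithin 0 (Set.Ioi 0)) (nhds 0)) ∧
      (∀ v : ℝ → ℝ,
        ((∀ r ∈ Set.Ioc 0 r₀, HasDerivAt v (G r - f r * v r) r) ∧
          Tendsto (fun r : ℝ => r ^ β * v r) (nhdsWithin 0 (Set.Ioi 0)) (nhds 0)) →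
        ∀ r ∈ Set.Ioc 0 r₀, v r = u r) ∧
      (∀ r ∈ Set.Ioc 0 r₀,
        |u r| ≤ (M / δ) * Real.exp (8 * B * r₀ ^ ((1 : ℝ)/4)) * r ^ (-β + δ)) := by
  obtain ⟨φ, hφ_deriv, hφ_le⟩ := exists_integratingFactor hr₀ hB hf_cont hf
  set E := 4 * B * r₀ ^ ((1 : ℝ)/4) with hE
  have hφ_pos : ∀ r ∈ Set.Ioc 0 r₀, 0 < φ r := fun r hr =>
    (mul_pos (Real.exp_pos _) (Real.rpow_pos_of_pos hr.1 β)).trans_le (hφ_le r hr).1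
  set g : ℝ → ℝ := fun x => φ (min x r₀) * G (min x r₀) with g_def
  have hg : ∀ r ∈ Set.Ioc 0 r₀, g r = φ r * G r := fun r hr => by
    simp only [g_def, min_eq_left hr.2]
  have hφ_cont : ContinuousOn φ (Set.Ioc 0 r₀) := fun r hr =>
    (hφ_deriv r hr).continuousAt.continuousWithinAt
  have hg_cont : ContinuousOn g (Set.Ioi 0) :=
    (hφ_cont.comp_min_Ioi hr₀).mul (hG_cont.comp_min_Ioi hr₀)
  have hg_le : ∀ r ∈ Set.Ioc 0 r₀, |g r| ≤ Real.exp E * M * r ^ (δ - 1) := by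
    intro r hr
    rw [hg r hr, abs_mul, abs_of_pos (hφ_pos r hr)]
    calc φ r * |G r| ≤ (Real.exp E * r ^ β) * (M * r ^ (-β - 1 + δ)) :=
          mul_le_mul (hφ_le r hr).2 (hG r hr) (abs_nonneg _)
            (mul_nonneg (Real.exp_pos _).le (Real.rpow_nonneg hr.1.le β))
      _ = Real.exp E * M * (r ^ β * r ^ (-β - 1 + δ)) := by ring
      _ = Real.exp E * M * r ^ (δ - 1) := by
          rw [← Real.rpow_add hr.1]
          ring_nf
  set W : ℝ → ℝ := fun r => ∫ s in (0 : ℝ)..r, g s with W_def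
  have hg_le' : ∀ r ∈ Set.Ioc 0 r₀, ∀ s ∈ Set.Ioc 0 r, |g s| ≤ Real.exp E * M * s ^ (δ - 1) :=
    fun r hr s hs => hg_le s ⟨hs.1, hs.2.trans hr.2⟩
  have hW_deriv : ∀ r ∈ Set.Ioc 0 r₀, HasDerivAt W (φ r * G r) r := by
    intro r hr
    rw [← hg r hr]
    exact hasDerivAt_intervalIntegral_of_continuousOn_Ioi hr.1 hg_cont
      (intervalIntegrable_zero_of_le_rpow hδ.1 hr.1.le hg_cont (hg_le' r hr))
  have hW_le : ∀ r ∈ Set.Ioc 0 r₀, |W r| ≤ Real.exp E * M / δ * r ^ δ := fun r hr =>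
    abs_intervalIntegral_le_of_le_rpow (by positivity) hδ.1 le_rfl hr.1.le (hg_le' r hr)
  have hW_lim : Tendsto W (nhdsWithin 0 (Set.Ioi 0)) (nhds 0) := by
    have hlim : Tendsto (fun r : ℝ => Real.exp E * M / δ * r ^ δ)
        (nhdsWithin 0 (Set.Ioi 0)) (nhds 0) := by
      have := ((Real.continuousAt_rpow_const 0 δ (Or.inr hδ.1.le)).tendsto.const_mul
        (Real.exp E * M / δ)).mono_left (nhdsWithin_le_nhds (s := Set.Ioi 0))
      simpa [Real.zero_rpow hδ.1.ne'] using this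
    exact squeeze_zero_norm' (by filter_upwards [Ioc_mem_nhdsGT hr₀] with r hr using hW_le r hr)
      hlim
  have hinv_le : ∀ r ∈ Set.Ioc 0 r₀, (φ r)⁻¹ ≤ Real.exp E * r ^ (-β) := by
    intro r hr
    have hpos := mul_pos (Real.exp_pos (-E)) (Real.rpow_pos_of_pos hr.1 β)
    refine (inv_anti₀ hpos (hφ_le r hr).1).trans_eq ?_
    rw [mul_inv, ← Real.exp_neg, neg_neg, Real.rpow_neg hr.1.le]
  have hmain : ∀ r ∈ Set.Ioc 0 r₀, |W r / φ r| ≤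
      (M / δ) * Real.exp (8 * B * r₀ ^ ((1 : ℝ)/4)) * r ^ (-β + δ) := by
    intro r hr
    have hrp := Real.rpow_nonneg hr.1.le δ
    have hδ_pos := hδ.1
    rw [div_eq_mul_inv, abs_mul, abs_of_pos (inv_pos.2 (hφ_pos r hr))]
    calc |W r| * (φ r)⁻¹ ≤ (Real.exp E * M / δ * r ^ δ) * (Real.exp E * r ^ (-β)) :=
          mul_le_mul (hW_le r hr) (hinv_le r hr) (inv_pos.2 (hφ_pos r hr)).le (by positivity)
      _ = (M / δ) * (Real.exp E * Real.exp E) * (r ^ (-β) * r ^ δ) := by ring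
      _ = (M / δ) * Real.exp (8 * B * r₀ ^ ((1 : ℝ)/4)) * r ^ (-β + δ) := by
          rw [← Real.exp_add, ← Real.rpow_add hr.1, hE]
          ring_nf
  refine ⟨fun r => W r / φ r, ⟨fun r hr => ?_, ?_⟩, fun v hv r hr => ?_, hmain⟩
  · have hne := (hφ_pos r hr).ne'
    refine ((hW_deriv r hr).div (hφ_deriv r hr) hne).congr_deriv ?_
    field_simp
  · refine squeeze_zero_norm' (a := fun r => Real.exp E * |W r|) ?_
      (by simpa using hW_lim.abs.const_mul (Real.exp E))
    filter_upwards [Ioc_mem_nhdsGT hr₀] with r hr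
    have hrp := Real.rpow_pos_of_pos hr.1 β
    rw [Real.norm_eq_abs, abs_mul, abs_div, abs_of_pos hrp, abs_of_pos (hφ_pos r hr)]
    calc r ^ β * (|W r| / φ r) = |W r| * (r ^ β * (φ r)⁻¹) := by ring
      _ ≤ |W r| * (r ^ β * (Real.exp E * r ^ (-β))) := by
          gcongr
          exact hinv_le r hr
      _ = Real.exp E * |W r| := by
          rw [Real.rpow_neg hr.1.le]
          field_simp
  · have hzero := eq_zero_of_hasDerivAt_zero_of_tendsto_zero (g := fun r => φ r * v r - W r)
      (b := r₀) (fun s hs => ?_) ?_ r hr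
    · rw [eq_div_iff (hφ_pos r hr).ne']
      linarith
    · refine (((hφ_deriv s hs).mul (hv.1 s hs)).sub (hW_deriv s hs)).congr_deriv ?_
      ring
    · have hlim : Tendsto (fun r => φ r * v r) (nhdsWithin 0 (Set.Ioi 0)) (nhds 0) := by
        refine squeeze_zero_norm' (a := fun r => Real.exp E * |r ^ β * v r|) ?_
          (by simpa using hv.2.abs.const_mul (Real.exp E))
        filter_upwards [Ioc_mem_nhdsGT hr₀] with s hs
        rw [Real.norm_eq_abs, abs_mul, abs_mul, abs_of_pos (hφ_pos s hs),
          abs_of_pos (Real.rpow_pos_of_pos hs.1 β), ← mul_assoc]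
        exact mul_le_mul_of_nonneg_right (hφ_le s hs).2 (abs_nonneg _)
      simpa using hlim.sub hW_lim
end

section
/- Two-sided bounds and limiting behaviour for homogeneous Fuchsian ODEs: Let a ∈ ℝ, r₀ > 0 and B > 0. Let f : (0, r₀] → ℝ be continuous with |f(r) − a/r| ≤ B r^{−3/4} for all r ∈ (0, r₀], and let y : (0, r₀] → ℝ be differentiable with y'(r) + f(r) y(r) = 0 for all r ∈ (0, r₀]. Then for every r ∈ (0, r₀]: exp(−4 B r₀^{1/4}) (r₀/r)^{a} |y(r₀)| ≤ |y(r)| ≤ exp(4 B r₀^{1/4}) (r₀/r)^{a} |y(r₀)|; moreover the limit of r^{a} y(r) as r → 0⁺ exists. -/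
open Filter

open Set Real

/-- Multiplying a solution of the linear equation with coefficient `f` by `r ^ a` removes
the singular part `a / r` of `f`. -/
lemma hasDerivAt_rpow_mul_of_linear_ode {a r : ℝ} (hr : 0 < r) {f y : ℝ → ℝ}
    (hy : HasDerivAt y (-(f r * y r)) r) :
    HasDerivAt (fun s => s ^ a * y s) (-((f r - a / r) * (r ^ a * y r))) r := by
  refine ((Real.hasDerivAt_rpow_const (p := a) (Or.inl hr.ne')).mul hy).congr_deriv ?_
  rw [Real.rpow_sub_one hr.ne']
  field_simp
  ring

lemma hasDerivAt_four_mul_rpow_quarter (B : ℝ) {r : ℝ} (hr : 0 < r) :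
    HasDerivAt (fun s : ℝ => 4 * B * s ^ ((1 : ℝ) / 4)) (B * r ^ (-(3 : ℝ) / 4)) r := by
  refine ((Real.hasDerivAt_rpow_const (Or.inl hr.ne')).const_mul (4 * B)).congr_deriv ?_
  norm_num
  ring

lemma monotoneOn_Ioc_of_hasDerivAt_nonneg {u u' : ℝ → ℝ} {b c : ℝ}
    (hu : ∀ r ∈ Ioc b c, HasDerivAt u (u' r) r) (hu' : ∀ r ∈ Ioc b c, 0 ≤ u' r) :
    MonotoneOn u (Ioc b c) :=
  monotoneOn_of_hasDerivWithinAt_nonneg (convex_Ioc b c)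
    (fun r hr => (hu r hr).continuousAt.continuousWithinAt)
    (fun r hr => (hu r (interior_subset hr)).hasDerivWithinAt)
    (fun r hr => hu' r (interior_subset hr))

/-- Grönwall inequality: if `z` solves the linear equation with coefficient `g`, and `g` is at most
the derivative of `φ`, then `|z| * exp φ` is nondecreasing. -/
lemma monotoneOn_abs_mul_exp {z g φ φ' : ℝ → ℝ} {b c : ℝ}
    (hz : ∀ r ∈ Ioc b c, HasDerivAt z (-(g r * z r)) r)
    (hφ : ∀ r ∈ Ioc b c, HasDerivAt φ (φ' r) r) (hg : ∀ r ∈ Ioc b c, g r ≤ φ' r) :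
    MonotoneOn (fun r => |z r| * exp (φ r)) (Ioc b c) := by
  have hsq : MonotoneOn (fun r => (z r * exp (φ r)) ^ 2) (Ioc b c) := by
    refine monotoneOn_Ioc_of_hasDerivAt_nonneg
      (u' := fun r => 2 * (z r * exp (φ r)) ^ 2 * (φ' r - g r)) (fun r hr => ?_) (fun r hr => ?_)
    · refine (((hz r hr).mul (hφ r hr).exp).pow 2).congr_deriv ?_
      simp only [Pi.mul_apply]
      push_cast
      ring
    · exact mul_nonneg (by positivity) (sub_nonneg.2 (hg r hr))
  intro r hr s hs hrs
  have h := sq_le_sq.1 (hsq hr hs hrs)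
  simpa only [abs_mul, abs_exp] using h

/-- The mirror image of `monotoneOn_abs_mul_exp`. -/
lemma antitoneOn_abs_mul_exp_neg {z g φ φ' : ℝ → ℝ} {b c : ℝ}
    (hz : ∀ r ∈ Ioc b c, HasDerivAt z (-(g r * z r)) r)
    (hφ : ∀ r ∈ Ioc b c, HasDerivAt φ (φ' r) r) (hg : ∀ r ∈ Ioc b c, -φ' r ≤ g r) :
    AntitoneOn (fun r => |z r| * exp (-φ r)) (Ioc b c) := by
  have hsq : MonotoneOn (fun r => -(z r * exp (-φ r)) ^ 2) (Ioc b c) := by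
    refine monotoneOn_Ioc_of_hasDerivAt_nonneg
      (u' := fun r => 2 * (z r * exp (-φ r)) ^ 2 * (φ' r + g r)) (fun r hr => ?_) (fun r hr => ?_)
    · refine (((hz r hr).mul (hφ r hr).neg.exp).pow 2).neg.congr_deriv ?_
      simp only [Pi.mul_apply, Pi.neg_apply]
      push_cast
      ring
    · exact mul_nonneg (by positivity) (by linarith [hg r hr])
  intro r hr s hs hrs
  have h := sq_le_sq.1 (neg_le_neg_iff.1 (hsq hr hs hrs))
  simpa only [abs_mul, abs_exp] using h

/-- A bounded function whose derivative is dominated by that of a function tending to `0`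
has a one-sided limit. -/
lemma exists_tendsto_nhdsGT_of_abs_deriv_le {z z' ψ ψ' : ℝ → ℝ} {b c C : ℝ} (hbc : b < c)
    (hz : ∀ r ∈ Ioc b c, HasDerivAt z (z' r) r) (hψ : ∀ r ∈ Ioc b c, HasDerivAt ψ (ψ' r) r)
    (hzψ : ∀ r ∈ Ioc b c, |z' r| ≤ ψ' r) (hzC : ∀ r ∈ Ioc b c, |z r| ≤ C)
    (hψ_nonneg : ∀ r ∈ Ioc b c, 0 ≤ ψ r) (hψ_lim : Tendsto ψ (nhdsWithin b (Ioi b)) (nhds 0)) :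
    ∃ L : ℝ, Tendsto z (nhdsWithin b (Ioi b)) (nhds L) := by
  have hmono : MonotoneOn (fun r => z r + ψ r) (Ioc b c) :=
    monotoneOn_Ioc_of_hasDerivAt_nonneg (fun r hr => (hz r hr).add (hψ r hr))
      (fun r hr => by linarith [neg_abs_le (z' r), hzψ r hr])
  have hbdd : BddBelow ((fun r => z r + ψ r) '' Ioo b c) := by
    refine ⟨-C, ?_⟩
    rintro _ ⟨r, hr, rfl⟩
    have hr' := Ioo_subset_Ioc_self hr
    linarith [neg_abs_le (z r), hzC r hr', hψ_nonneg r hr']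
  have hlim := (hmono.mono Ioo_subset_Ioc_self).tendsto_nhdsWithin_Ioo_right
    (nonempty_Ioo.2 hbc) hbdd
  exact ⟨_, by simpa using hlim.sub hψ_lim⟩

/-- Two-sided bounds and limiting behaviour for homogeneous Fuchsian ODEs:
solutions behave like `const · r^{-a} (1 + O(r^{1/4}))` near the singularity. -/
theorem fuchsian_homogeneous_bounds
    (a r₀ B : ℝ) (hr₀ : 0 < r₀) (hB : 0 < B)
    (f : ℝ → ℝ)
    (hf_cont : ContinuousOn f (Set.Ioc 0 r₀))
    (hf : ∀ r ∈ Set.Ioc 0 r₀, |f r - a / r| ≤ B * r ^ (-(3 : ℝ)/4))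
    (y : ℝ → ℝ)
    (hy : ∀ r ∈ Set.Ioc 0 r₀, HasDerivAt y (-(f r * y r)) r) :
    (∀ r ∈ Set.Ioc 0 r₀,
      Real.exp (-(4 * B * r₀ ^ ((1 : ℝ)/4))) * (r₀ / r) ^ a * |y r₀| ≤ |y r| ∧
      |y r| ≤ Real.exp (4 * B * r₀ ^ ((1 : ℝ)/4)) * (r₀ / r) ^ a * |y r₀|) ∧
    ∃ L : ℝ, Tendsto (fun r : ℝ => r ^ a * y r) (nhdsWithin 0 (Set.Ioi 0)) (nhds L) := by
  set φ : ℝ → ℝ := fun r => 4 * B * r ^ ((1 : ℝ) / 4) with hφ_def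
  set z : ℝ → ℝ := fun r => r ^ a * y r with hz_def
  have hz : ∀ r ∈ Ioc 0 r₀, HasDerivAt z (-((f r - a / r) * z r)) r :=
    fun r hr => hasDerivAt_rpow_mul_of_linear_ode hr.1 (hy r hr)
  have hφ : ∀ r ∈ Ioc 0 r₀, HasDerivAt φ (B * r ^ (-(3 : ℝ) / 4)) r :=
    fun r hr => hasDerivAt_four_mul_rpow_quarter B hr.1
  have hφ_nonneg : ∀ r ∈ Ioc 0 r₀, 0 ≤ φ r := fun r hr => by
    have := hr.1
    positivity
  have hr₀_mem : r₀ ∈ Ioc 0 r₀ := ⟨hr₀, le_rfl⟩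
  have hupper : ∀ r ∈ Ioc 0 r₀, |z r| ≤ exp (φ r₀) * |z r₀| := fun r hr => by
    have h := monotoneOn_abs_mul_exp hz hφ (fun s hs => (abs_le.1 (hf s hs)).2) hr hr₀_mem hr.2
    calc |z r| ≤ |z r| * exp (φ r) :=
          le_mul_of_one_le_right (abs_nonneg _) (one_le_exp (hφ_nonneg r hr))
      _ ≤ |z r₀| * exp (φ r₀) := h
      _ = exp (φ r₀) * |z r₀| := mul_comm _ _
  have hlower : ∀ r ∈ Ioc 0 r₀, exp (-φ r₀) * |z r₀| ≤ |z r| := fun r hr => by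
    have h := antitoneOn_abs_mul_exp_neg hz hφ (fun s hs => (abs_le.1 (hf s hs)).1) hr hr₀_mem hr.2
    calc exp (-φ r₀) * |z r₀| = |z r₀| * exp (-φ r₀) := mul_comm _ _
      _ ≤ |z r| * exp (-φ r) := h
      _ ≤ |z r| := mul_le_of_le_one_right (abs_nonneg _)
          (exp_le_one_iff.2 (neg_nonpos.2 (hφ_nonneg r hr)))
  have habs : ∀ r ∈ Ioc 0 r₀, |z r| = r ^ a * |y r| := fun r hr => by
    rw [hz_def, abs_mul, abs_of_pos (rpow_pos_of_pos hr.1 a)]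
  refine ⟨fun r hr => ?_, ?_⟩
  · have hra : 0 < r ^ a := rpow_pos_of_pos hr.1 a
    have hlo := hlower r hr
    have hup := hupper r hr
    rw [habs r hr, habs r₀ hr₀_mem] at hlo hup
    rw [div_rpow hr₀.le hr.1.le]
    constructor
    · refine le_of_mul_le_mul_left ?_ hra
      refine (Eq.le ?_).trans hlo
      field_simp
      exact mul_comm _ _
    · refine le_of_mul_le_mul_left ?_ hra
      refine hup.trans (Eq.le ?_)
      field_simp
      exact mul_comm _ _
  · set C := exp (φ r₀) * |z r₀|
    have hφ_lim : Tendsto φ (nhdsWithin 0 (Ioi 0)) (nhds 0) := by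
      have h : ContinuousAt φ 0 :=
        continuousAt_const.mul (continuousAt_rpow_const 0 _ (Or.inr (by norm_num)))
      simpa [hφ_def] using h.tendsto.mono_left nhdsWithin_le_nhds
    refine exists_tendsto_nhdsGT_of_abs_deriv_le (ψ := fun r => φ r * C) hr₀ hz
      (fun r hr => (hφ r hr).mul_const C) (fun r hr => ?_) hupper
      (fun r hr => mul_nonneg (hφ_nonneg r hr) (by positivity))
      (by simpa using hφ_lim.mul_const C)
    rw [abs_neg, abs_mul]
    exact mul_le_mul (hf r hr) (hupper r hr) (abs_nonneg _) ((abs_nonneg _).trans (hf r hr))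
end
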